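/- arXiv:2209.04807 — 2 statements merged into one kernel-verified Lean document; each statement's English description precedes it below -/
import Mathlib

section
/- Let u ∈ K^n satisfy f(A)^ℓ u = 0 and f(A)^{ℓ−1} u ≠ 0 for some ℓ ≥ 1. Then Span_ℂ{ p^{(k)}(α,u) : α a root of f in ℂ, 1 ≤ k ≤ ℓ } = Span_ℂ{ A^j u : j ≥ 0 } as subspaces of ℂ^n; that is, P_A(u) equals the extension ℂ ⊗_K L_A(u) of the Krylov subspace of u to scalars in ℂ. -/
open Polynomial Matrix
set_option synthInstance.maxHeartbeats 1000000
set_option maxHeartbeats 1000000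

/-- The complex matrix obtained from a matrix over a subfield `K` of `ℂ`. -/
noncomputable def matC (K : Subfield ℂ) {n : ℕ} (A : Matrix (Fin n) (Fin n) K) :
    Matrix (Fin n) (Fin n) ℂ :=
  A.map (fun x => (x : ℂ))

/-- The complex vector obtained from a vector over a subfield `K` of `ℂ`. -/
noncomputable def vecC (K : Subfield ℂ) {n : ℕ} (w : Fin n → K) : Fin n → ℂ :=
  fun i => (w i : ℂ)

/-- For a root `α` of `f`, the quotient `g_α(x) = f(x)/(x - α)` in `ℂ[x]`,
i.e. the paper's `ψ_f(x, α)`. -/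
noncomputable def galpha (K : Subfield ℂ) (f : Polynomial K) (α : ℂ) : Polynomial ℂ :=
  (f.map K.subtype) / (X - C α)

/-- The generalized eigenvector `p⁽ᵏ⁾(α, u) = g_α(A)^k · f(A)^(ℓ-k) · u`, where
`ℓ = rank_f u`. -/
noncomputable def pvec (K : Subfield ℂ) {n : ℕ} (A : Matrix (Fin n) (Fin n) K)
    (f : Polynomial K) (α : ℂ) (ℓ k : ℕ) (u : Fin n → K) : Fin n → ℂ :=
  ((Polynomial.aeval (matC K A) (galpha K f α)) ^ k *
    (Polynomial.aeval (matC K A) (f.map K.subtype)) ^ (ℓ - k)).mulVec (vecC K u)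

theorem aeval_matC_map_mulVec (K : Subfield ℂ) {n : ℕ} (A : Matrix (Fin n) (Fin n) K)
    (p : K[X]) (u : Fin n → K) :
    (aeval (matC K A) (p.map K.subtype)).mulVec (vecC K u) = vecC K ((aeval A p).mulVec u) := by
  have h : aeval (matC K A) (p.map K.subtype) = matC K (aeval A p) := by
    have h1 : ∀ M : Matrix (Fin n) (Fin n) K, matC K M = K.subtype.mapMatrix M := fun _ => rfl
    induction p using Polynomial.induction_on' with
    | add p q hp hq => rw [Polynomial.map_add, map_add, map_add, hp, hq, h1, h1, h1, map_add]
    | monomial m a =>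
      simp only [Polynomial.map_monomial, aeval_monomial, h1, map_mul, map_pow]
      congr 1
      ext i j
      by_cases hij : i = j <;> simp [Matrix.algebraMap_matrix_apply, hij]
  rw [h]
  ext i
  simp [matC, vecC, Matrix.mulVec, dotProduct]

theorem X_sub_C_mul_galpha (K : Subfield ℂ) {f : K[X]} {α : ℂ}
    (hα : (f.map K.subtype).IsRoot α) : (X - C α) * galpha K f α = f.map K.subtype :=
  mul_div_eq_iff_isRoot.mpr hα

theorem not_isRoot_galpha (K : Subfield ℂ) {f : K[X]} (hf : Irreducible f) {α : ℂ}
    (hα : (f.map K.subtype).IsRoot α) : ¬ (galpha K f α).IsRoot α := by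
  intro h
  have hsep : (f.map K.subtype).Separable := (Irreducible.separable hf).map
  obtain ⟨q, hq⟩ := dvd_iff_isRoot.mpr h
  refine not_isUnit_X_sub_C α (hsep.squarefree (X - C α) ⟨q, ?_⟩)
  rw [mul_assoc, ← hq, X_sub_C_mul_galpha K hα]

theorem span_galpha_pow_eq_top (K : Subfield ℂ) {f : K[X]} (hf : Irreducible f) (ℓ : ℕ) :
    Ideal.span {p : ℂ[X] | ∃ α, (f.map K.subtype).IsRoot α ∧ p = galpha K f α ^ ℓ} = ⊤ := by
  set I := Ideal.span {p : ℂ[X] | ∃ α, (f.map K.subtype).IsRoot α ∧ p = galpha K f α ^ ℓ}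
  obtain ⟨d, hd⟩ := (IsPrincipalIdealRing.principal I).principal
  have hdvd : ∀ α, (f.map K.subtype).IsRoot α → d ∣ galpha K f α ^ ℓ := by
    intro α hα
    rw [← Ideal.mem_span_singleton, Ideal.span, ← hd]
    exact Ideal.subset_span ⟨α, hα, rfl⟩
  rw [hd]
  refine Ideal.span_singleton_eq_top.mpr ?_
  by_contra hu
  have hroot : ∀ p : ℂ[X], p ≠ 0 → ¬ IsUnit p → ∃ β, p.IsRoot β := fun p h0 hp =>
    IsAlgClosed.exists_root p fun h => hp (isUnit_iff_degree_eq_zero.mpr h)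
  have hF0 : f.map K.subtype ≠ 0 := (Polynomial.map_ne_zero_iff K.subtype.injective).mpr hf.ne_zero
  obtain ⟨α, hα⟩ := IsAlgClosed.exists_root (f.map K.subtype)
    (by rw [degree_map]; exact hf.degree_pos.ne')
  have hg0 : galpha K f α ≠ 0 := fun h => hF0 (by rw [← X_sub_C_mul_galpha K hα, h, mul_zero])
  have hd0 : d ≠ 0 := fun h => pow_ne_zero ℓ hg0 (zero_dvd_iff.mp (h ▸ hdvd α hα))
  obtain ⟨β, hβ⟩ := hroot d hd0 hu
  have key : ∀ γ, (f.map K.subtype).IsRoot γ → (galpha K f γ).IsRoot β := by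
    intro γ hγ
    have h := hβ.dvd (hdvd γ hγ)
    rw [IsRoot.def, eval_pow] at h
    exact eq_zero_of_pow_eq_zero h
  have hβF : (f.map K.subtype).IsRoot β :=
    (key α hα).dvd ⟨X - C α, by rw [mul_comm, X_sub_C_mul_galpha K hα]⟩
  exact not_isRoot_galpha K hf hβF (key β hβF)

theorem stmt17 (K : Subfield ℂ) (n : ℕ) (hn : 1 ≤ n)
    (A : Matrix (Fin n) (Fin n) K) (f : Polynomial K)
    (hmonic : f.Monic) (hirr : Irreducible f) (hdvd : f ∣ A.charpoly)
    (u : Fin n → K) (ℓ : ℕ) (hℓ : 1 ≤ ℓ)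
    (hker : ((Polynomial.aeval A f) ^ ℓ).mulVec u = 0)
    (hker' : ((Polynomial.aeval A f) ^ (ℓ - 1)).mulVec u ≠ 0) :
    Submodule.span ℂ
        {v : Fin n → ℂ | ∃ (α : ℂ) (k : ℕ), (f.map K.subtype).IsRoot α ∧
          1 ≤ k ∧ k ≤ ℓ ∧ v = pvec K A f α ℓ k u} =
      Submodule.span ℂ
        (Set.range fun j : ℕ => ((matC K A) ^ j).mulVec (vecC K u)) := by
  set S := Submodule.span ℂ {v : Fin n → ℂ | ∃ (α : ℂ) (k : ℕ), (f.map K.subtype).IsRoot α ∧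
    1 ≤ k ∧ k ≤ ℓ ∧ v = pvec K A f α ℓ k u}
  have hkerC : (aeval (matC K A) ((f.map K.subtype) ^ ℓ)).mulVec (vecC K u) = 0 := by
    rw [← Polynomial.map_pow, aeval_matC_map_mulVec, map_pow, hker]
    ext i
    simp [vecC]
  apply le_antisymm
  · refine Submodule.span_le.mpr ?_
    rintro v ⟨α, k, -, -, -, rfl⟩
    rw [pvec, ← map_pow, ← map_pow, ← map_mul, aeval_eq_sum_range, Matrix.sum_mulVec]
    refine Submodule.sum_mem _ fun j _ => ?_
    rw [Matrix.smul_mulVec]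
    exact Submodule.smul_mem _ _ (Submodule.subset_span ⟨j, rfl⟩)
  · have hshift : ∀ α, (f.map K.subtype).IsRoot α → ∀ j : ℕ,
        (aeval (matC K A) ((X - C α) ^ j * galpha K f α ^ ℓ)).mulVec (vecC K u) ∈ S := by
      intro α hα j
      rcases lt_or_ge j ℓ with hj | hj
      · refine Submodule.subset_span ⟨α, ℓ - j, hα, by omega, by omega, ?_⟩
        rw [pvec, ← map_pow, ← map_pow, ← map_mul, Nat.sub_sub_self hj.le,
          ← X_sub_C_mul_galpha K hα, mul_pow]
        congr 2
        rw [mul_left_comm, ← pow_add, Nat.sub_add_cancel hj.le]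
      · have h : (X - C α) ^ j * galpha K f α ^ ℓ =
            (X - C α) ^ (j - ℓ) * (f.map K.subtype) ^ ℓ := by
          rw [← X_sub_C_mul_galpha K hα, mul_pow, ← mul_assoc, ← pow_add,
            Nat.sub_add_cancel hj]
        rw [h, map_mul, ← Matrix.mulVec_mulVec, hkerC, Matrix.mulVec_zero]
        exact S.zero_mem
    have hmul : ∀ α, (f.map K.subtype).IsRoot α → ∀ q : ℂ[X],
        (aeval (matC K A) (q * galpha K f α ^ ℓ)).mulVec (vecC K u) ∈ S := by
      intro α hα q
      rw [← sum_taylor_eq q α, Polynomial.sum, Finset.sum_mul, map_sum, Matrix.sum_mulVec]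
      refine Submodule.sum_mem _ fun j _ => ?_
      rw [mul_assoc, ← smul_eq_C_mul, map_smul, Matrix.smul_mulVec]
      exact S.smul_mem _ (hshift α hα j)
    have hall : ∀ p : ℂ[X], ∀ q : ℂ[X],
        (aeval (matC K A) (q * p)).mulVec (vecC K u) ∈ S := by
      intro p
      have hp : p ∈ Ideal.span {p : ℂ[X] | ∃ α, (f.map K.subtype).IsRoot α ∧
          p = galpha K f α ^ ℓ} := by
        rw [span_galpha_pow_eq_top K hirr]; trivial
      induction hp using Submodule.span_induction with
      | mem x hx =>
        obtain ⟨α, hα, rfl⟩ := hx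
        exact hmul α hα
      | zero => intro q; simp
      | add x y _ _ hx hy =>
        intro q
        rw [mul_add, map_add, Matrix.add_mulVec]
        exact S.add_mem (hx q) (hy q)
      | smul a x _ hx =>
        intro q
        rw [smul_eq_mul, ← mul_assoc]
        exact hx (q * a)
    refine Submodule.span_le.mpr ?_
    rintro _ ⟨j, rfl⟩
    simpa using hall 1 (X ^ j)
end

section
/- Let ℓ̄ be the multiplicity of f in the minimal polynomial of A, suppose b_1, …, b_r ∈ ker f(A)^ℓ̄ are Jordan–Krylov independent with respect to A, and let α ∈ ℂ be a root of f. Then the subspaces P_A(α,b_1), P_A(α,b_2), …, P_A(α,b_r) of ℂ^n form an independent family (satisfy the direct sum condition). -/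
open Polynomial Matrix
set_option synthInstance.maxHeartbeats 1000000
set_option maxHeartbeats 1000000

/-- `rank_f u`: the least `ℓ` with `f(A)^ℓ u = 0`. -/
noncomputable def rankf (K : Subfield ℂ) {n : ℕ} (A : Matrix (Fin n) (Fin n) K)
    (f : Polynomial K) (u : Fin n → K) : ℕ :=
  sInf {ℓ : ℕ | ((Polynomial.aeval A f) ^ ℓ).mulVec u = 0}

/-- The subspace `P_A(α, u) = Span_ℂ {p⁽ᵏ⁾(α, u) : 1 ≤ k ≤ rank_f u}` of `ℂ^n`. -/
noncomputable def Pspace (K : Subfield ℂ) {n : ℕ} (A : Matrix (Fin n) (Fin n) K)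
    (f : Polynomial K) (α : ℂ) (u : Fin n → K) : Submodule ℂ (Fin n → ℂ) :=
  Submodule.span ℂ
    ((fun k => pvec K A f α (rankf K A f u) k u) '' Set.Icc 1 (rankf K A f u))

/-- The Krylov subspace `L_A(u) = Span_K {A^k u : k ≥ 0}`. -/
noncomputable def krylov (K : Subfield ℂ) {n : ℕ} (A : Matrix (Fin n) (Fin n) K)
    (u : Fin n → K) : Submodule K (Fin n → K) :=
  Submodule.span K (Set.range fun k : ℕ => (A ^ k).mulVec u)

/-- `B` is a Jordan–Krylov basis of `ker f(A)^ℓ̄` with respect to `A`: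
it is a finite subset of `ker f(A)^ℓ̄`, the family of Krylov subspaces of its elements
is independent, and their sum is `ker f(A)^ℓ̄`. -/
def IsJordanKrylovBasis (K : Subfield ℂ) {n : ℕ} (A : Matrix (Fin n) (Fin n) K)
    (f : Polynomial K) (lbar : ℕ) (B : Finset (Fin n → K)) : Prop :=
  (∀ b ∈ B, ((Polynomial.aeval A f) ^ lbar).mulVec b = 0) ∧
  iSupIndep (fun b : B => krylov K A b.val) ∧
  (⨆ b ∈ B, krylov K A b) = LinearMap.ker (((Polynomial.aeval A f) ^ lbar).mulVecLin)

theorem mulVec_vecC (K : Subfield ℂ) {n : ℕ} (M : Matrix (Fin n) (Fin n) K) (w : Fin n → K) :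
    (matC K M).mulVec (vecC K w) = vecC K (M.mulVec w) :=
  funext fun i => (RingHom.map_mulVec K.subtype M w i).symm

theorem matC_pow (K : Subfield ℂ) {n : ℕ} (A : Matrix (Fin n) (Fin n) K) (k : ℕ) :
    matC K (A ^ k) = matC K A ^ k :=
  map_pow K.subtype.mapMatrix A k

/-- Independence of subspaces of `K^n` is preserved by extension of scalars to `ℂ`. -/
theorem iSupIndep_span_image_vecC (K : Subfield ℂ) {n : ℕ} {ι : Type*}
    {L : ι → Submodule K (Fin n → K)} (hL : iSupIndep L) :
    iSupIndep fun i => Submodule.span ℂ (vecC K '' (L i : Set (Fin n → K))) := by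
  intro i
  obtain ⟨q, hq, hc⟩ := (hL i).symm.exists_isCompl
  set M := LinearMap.toMatrix' ((L i).projection q hc.symm) with hM
  have hproj (w : Fin n → K) : (matC K M).mulVec (vecC K w) =
      vecC K ((L i).projection q hc.symm w) := by
    rw [mulVec_vecC, hM, LinearMap.toMatrix'_mulVec]
  have hfix : Submodule.span ℂ (vecC K '' (L i : Set (Fin n → K))) ≤
      LinearMap.eqLocus (matC K M).mulVecLin LinearMap.id := by
    rw [Submodule.span_le]
    rintro _ ⟨w, hw, rfl⟩
    simp [hproj, Submodule.projection_apply_of_mem_left hc.symm hw]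
  have hker : ⨆ j ≠ i, Submodule.span ℂ (vecC K '' (L j : Set (Fin n → K))) ≤
      LinearMap.ker (matC K M).mulVecLin := by
    refine iSup₂_le fun j hj => Submodule.span_le.2 ?_
    rintro _ ⟨w, hw, rfl⟩
    have hwq : w ∈ q := hq ((le_iSup₂ (f := fun j (_ : j ≠ i) => L j) j hj) hw)
    have h0 := (Submodule.projection_apply_eq_zero_iff hc.symm).2 hwq
    have hz : vecC K (0 : Fin n → K) = 0 := by ext; simp [vecC]
    simp [hproj, h0, hz]
  rw [Submodule.disjoint_def]
  intro x hx hx'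
  have h1 : (matC K M).mulVecLin x = x := hfix hx
  exact h1.symm.trans (hker hx')

theorem aeval_mulVec_vecC_mem (K : Subfield ℂ) {n : ℕ} (A : Matrix (Fin n) (Fin n) K)
    (p : Polynomial ℂ) (u : Fin n → K) :
    (Polynomial.aeval (matC K A) p).mulVec (vecC K u) ∈
      Submodule.span ℂ (vecC K '' (krylov K A u : Set (Fin n → K))) := by
  rw [Polynomial.aeval_eq_sum_range, Matrix.sum_mulVec]
  refine Submodule.sum_mem _ fun k _ => ?_
  rw [Matrix.smul_mulVec, ← matC_pow, mulVec_vecC]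
  exact Submodule.smul_mem _ _ (Submodule.subset_span
    ⟨_, Submodule.subset_span ⟨k, rfl⟩, rfl⟩)

theorem Pspace_le_span_krylov (K : Subfield ℂ) {n : ℕ} (A : Matrix (Fin n) (Fin n) K)
    (f : Polynomial K) (α : ℂ) (u : Fin n → K) :
    Pspace K A f α u ≤ Submodule.span ℂ (vecC K '' (krylov K A u : Set (Fin n → K))) := by
  refine Submodule.span_le.2 ?_
  rintro _ ⟨k, -, rfl⟩
  simp only [pvec, ← map_pow, ← map_mul]
  exact aeval_mulVec_vecC_mem K A _ u

theorem stmt18 (K : Subfield ℂ) (n : ℕ) (hn : 1 ≤ n)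
    (A : Matrix (Fin n) (Fin n) K) (f : Polynomial K)
    (hmonic : f.Monic) (hirr : Irreducible f) (hdvd : f ∣ A.charpoly)
    (lbar : ℕ) (hl1 : f ^ lbar ∣ minpoly K A) (hl2 : ¬ f ^ (lbar + 1) ∣ minpoly K A)
    (r : ℕ) (b : Fin r → (Fin n → K))
    (hbker : ∀ i, ((Polynomial.aeval A f) ^ lbar).mulVec (b i) = 0)
    (hbindep : iSupIndep (fun i : Fin r => krylov K A (b i)))
    (α : ℂ) (hα : (f.map K.subtype).IsRoot α) :
    iSupIndep (fun i : Fin r => Pspace K A f α (b i)) := by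
  exact (iSupIndep_span_image_vecC K hbindep).mono fun i =>
    Pspace_le_span_krylov K A f α (b i)
end
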